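/- (Lemma 3.2, existential content of Color-Small.) Let G be a finite simple graph, χ a proper partial edge coloring of G with palette C of size μ, and 𝒰 a separable collection of u-fans of size λ. Then there exists a proper partial edge coloring χ′ of G with palette C whose set of uncolored edges is a subset of the set of uncolored edges of χ, and the number of uncolored edges of χ′ is at most (number of uncolored edges of χ) − λ/100. -/

import Mathlib

open Classical

/-- A partial edge coloring `χ` of a graph `G` is *proper* if no two distinct edges of `G`
sharing a vertex receive the same color. -/
def Proper {V C : Type*} (G : SimpleGraph V) (χ : Sym2 V → Option C) : Prop :=
  ∀ e₁ ∈ G.edgeSet, ∀ e₂ ∈ G.edgeSet, e₁ ≠ e₂ →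
    (∃ x : V, x ∈ e₁ ∧ x ∈ e₂) → ∀ c : C, χ e₁ = some c → χ e₂ ≠ some c

/-- The set of uncolored edges of `G` under the partial coloring `χ`. -/
def uncolored {V C : Type*} (G : SimpleGraph V) (χ : Sym2 V → Option C) : Set (Sym2 V) :=
  {e | e ∈ G.edgeSet ∧ χ e = none}

/-- `missing G χ u` is the set of colors not assigned by `χ` to any edge of `G` incident on `u`. -/
def missing {V C : Type*} (G : SimpleGraph V) (χ : Sym2 V → Option C) (u : V) : Set C :=
  {c | ∀ e ∈ G.edgeSet, u ∈ e → χ e ≠ some c}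

/-- A u-fan: a center `u`, two leaves `v`, `w`, and assigned colors. -/
structure UFan (V : Type*) (C : Type*) where
  u : V
  v : V
  w : V
  cu : C
  cv : C
  cw : C

/-- The (uncolored) edges of a u-fan. -/
def UFan.edges {V C : Type*} (f : UFan V C) : Set (Sym2 V) := {s(f.u, f.v), s(f.u, f.w)}

/-- `f.assigns x c` means that `x` is a vertex of `f` and `c` is the color `c_f(x)`
 that `f` assigns to `x`. -/
def UFan.assigns {V C : Type*} (f : UFan V C) (x : V) (c : C) : Prop :=
  (x = f.u ∧ c = f.cu) ∨ (x = f.v ∧ c = f.cv) ∨ (x = f.w ∧ c = f.cw)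

/-- `f` is a u-fan with respect to the graph `G` and the proper partial coloring `χ`. -/
def IsUFan {V C : Type*} (G : SimpleGraph V) (χ : Sym2 V → Option C) (f : UFan V C) : Prop :=
  f.u ≠ f.v ∧ f.u ≠ f.w ∧ f.v ≠ f.w ∧
  s(f.u, f.v) ∈ uncolored G χ ∧ s(f.u, f.w) ∈ uncolored G χ ∧
  f.cu ∈ missing G χ f.u ∧ f.cv ∈ missing G χ f.v ∧ f.cw ∈ missing G χ f.w ∧
  f.cu ≠ f.cv ∧ f.cv = f.cw

/-- A collection of u-fans is separable if the u-fans are pairwise edge-disjoint and,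
for each vertex `x`, the colors assigned to `x` by the u-fans containing `x` are
pairwise distinct. -/
def Separable {V C : Type*} (𝒰 : Finset (UFan V C)) : Prop :=
  (∀ f ∈ 𝒰, ∀ g ∈ 𝒰, f ≠ g → Disjoint f.edges g.edges) ∧
  (∀ f ∈ 𝒰, ∀ g ∈ 𝒰, f ≠ g → ∀ (x : V) (c : C), f.assigns x c → ¬ g.assigns x c)

/-- In a finite graph of maximum degree at most two, a connected component contains at most two
vertices of degree at most one. -/
theorem SimpleGraph.not_three_ends {V : Type*} [Fintype V] (H : SimpleGraph V)
    (h2 : ∀ x, H.degree x ≤ 2) {a b c : V} (hab : a ≠ b) (hac : a ≠ c) (hbc : b ≠ c)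
    (ha : H.degree a ≤ 1) (hb : H.degree b ≤ 1) (hc : H.degree c ≤ 1)
    (rab : H.Reachable a b) (rac : H.Reachable a c) : False := by
  set K := H.connectedComponentMk a with hK
  have haK : a ∈ K.supp := rfl
  have hbK : b ∈ K.supp := (SimpleGraph.ConnectedComponent.sound rab).symm
  have hcK : c ∈ K.supp := (SimpleGraph.ConnectedComponent.sound rac).symm
  have hconn : (H.induce K.supp).Connected := K.connected_toSimpleGraph
  have hcard := hconn.card_vert_le_card_edgeSet_add_one
  have hdeg : ∀ x : K.supp, (H.induce K.supp).degree x ≤ H.degree x := fun x => by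
    rw [← SimpleGraph.card_neighborFinset_eq_degree, ← SimpleGraph.card_neighborFinset_eq_degree]
    refine Finset.card_le_card_of_injOn Subtype.val (fun y hy => ?_)
      Subtype.val_injective.injOn
    simpa using hy
  have hsum := (H.induce K.supp).sum_degrees_eq_twice_card_edges
  let T : Finset K.supp := {⟨a, haK⟩, ⟨b, hbK⟩, ⟨c, hcK⟩}
  have hT : T.card = 3 := by
    rw [Finset.card_eq_three]
    exact ⟨_, _, _, by simpa using hab, by simpa using hac, by simpa using hbc, rfl⟩
  have hle : ∑ x : K.supp, ((H.induce K.supp).degree x + if x ∈ T then 1 else 0)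
      ≤ ∑ _x : K.supp, 2 := by
    refine Finset.sum_le_sum fun x _ => ?_
    have h := hdeg x
    split_ifs with hx
    · have : H.degree x ≤ 1 := by
        simp only [T, Finset.mem_insert, Finset.mem_singleton] at hx
        rcases hx with rfl | rfl | rfl <;> assumption
      omega
    · exact h.trans (h2 x)
  rw [Finset.sum_add_distrib, hsum, Finset.sum_boole] at hle
  simp only [Finset.filter_univ_mem, hT, Finset.sum_const, Finset.card_univ, smul_eq_mul,
    Nat.cast_id] at hle
  rw [Nat.card_eq_fintype_card, Nat.card_eq_fintype_card, ← SimpleGraph.edgeFinset_card] at hcard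
  omega

section Kempe

variable {V C : Type*} (G : SimpleGraph V) (χ : Sym2 V → Option C)

/-- The graph of the edges of `G` colored `α` or `β`. -/
def kempeGraph (α β : C) : SimpleGraph V where
  Adj x y := G.Adj x y ∧ (χ s(x, y) = some α ∨ χ s(x, y) = some β)
  symm := ⟨fun x y h => by rw [Sym2.eq_swap]; exact ⟨h.1.symm, h.2⟩⟩
  loopless := ⟨fun _ h => h.1.ne rfl⟩

/-- Exchange the colors `α` and `β` on all edges meeting `K`. -/
noncomputable def kempeFlip (α β : C) (K : Set V) (e : Sym2 V) : Option C :=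
  if ∃ x ∈ e, x ∈ K then (χ e).map (Equiv.swap α β) else χ e

variable {G χ}

theorem Proper.eq_of_color_eq (hχ : Proper G χ) {x y z : V} (hy : G.Adj x y) (hz : G.Adj x z)
    {c : C} (h₁ : χ s(x, y) = some c) (h₂ : χ s(x, z) = some c) : y = z := by
  by_contra hne
  exact hχ s(x, y) hy s(x, z) hz (fun h => hne (Sym2.congr_right.1 h))
    ⟨x, Sym2.mem_mk_left _ _, Sym2.mem_mk_left _ _⟩ c h₁ h₂

theorem Proper.kempeGraph_degree_le_card [Fintype V] (hχ : Proper G χ) (α β : C) (x : V)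
    (S : Finset (Option C))
    (hS : ∀ y, (kempeGraph G χ α β).Adj x y → χ s(x, y) ∈ S) :
    (kempeGraph G χ α β).degree x ≤ S.card := by
  rw [← SimpleGraph.card_neighborFinset_eq_degree]
  refine Finset.card_le_card_of_injOn (fun y => χ s(x, y)) (fun y hy => hS y (by simpa using hy)) ?_
  intro y hy z hz hyz
  simp only [SimpleGraph.coe_neighborFinset, SimpleGraph.mem_neighborSet] at hy hz
  rcases hy.2 with h | h
  · exact hχ.eq_of_color_eq hy.1 hz.1 h (hyz.symm.trans h)
  · exact hχ.eq_of_color_eq hy.1 hz.1 h (hyz.symm.trans h)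

theorem Proper.kempeGraph_degree_le_two [Fintype V] (hχ : Proper G χ) (α β : C) (x : V) :
    (kempeGraph G χ α β).degree x ≤ 2 :=
  (hχ.kempeGraph_degree_le_card α β x {some α, some β}
    (fun y hy => by simpa using hy.2)).trans Finset.card_le_two

theorem Proper.kempeGraph_degree_le_one [Fintype V] (hχ : Proper G χ) {α β : C} {x : V}
    (hx : α ∈ missing G χ x ∨ β ∈ missing G χ x) :
    (kempeGraph G χ α β).degree x ≤ 1 := by
  rcases hx with h | h
  · refine hχ.kempeGraph_degree_le_card α β x {some β} fun y hy => ?_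
    simpa using hy.2.resolve_left (h _ hy.1 (Sym2.mem_mk_left _ _))
  · refine hχ.kempeGraph_degree_le_card α β x {some α} fun y hy => ?_
    simpa using hy.2.resolve_right (h _ hy.1 (Sym2.mem_mk_left _ _))

variable {α β : C} {K : Set V}

theorem kempeFlip_of_mem {x : V} (hx : x ∈ K) {e : Sym2 V} (hxe : x ∈ e) :
    kempeFlip χ α β K e = (χ e).map (Equiv.swap α β) :=
  if_pos ⟨x, hxe, hx⟩

theorem kempeFlip_of_notMem (hK : ∀ x y, (kempeGraph G χ α β).Adj x y → x ∈ K → y ∈ K)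
    {x : V} (hx : x ∉ K) {e : Sym2 V} (he : e ∈ G.edgeSet) (hxe : x ∈ e) :
    kempeFlip χ α β K e = χ e := by
  unfold kempeFlip
  split_ifs with h
  · obtain ⟨y, hye, hy⟩ := h
    obtain rfl : e = s(y, x) := (Sym2.mem_and_mem_iff (by rintro rfl; exact hx hy)).1 ⟨hye, hxe⟩
    have hcol : ¬ (χ s(y, x) = some α ∨ χ s(y, x) = some β) := fun hc => hx (hK y x ⟨he, hc⟩ hy)
    cases hc : χ s(y, x) with
    | none => rfl
    | some c =>
      rw [hc] at hcol
      simp only [Option.some.injEq, not_or] at hcol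
      rw [Option.map_some, Equiv.swap_apply_of_ne_of_ne hcol.1 hcol.2]
  · rfl

theorem mem_missing_kempeFlip_of_mem {x : V} (hx : x ∈ K) {c : C} :
    c ∈ missing G (kempeFlip χ α β K) x ↔ Equiv.swap α β c ∈ missing G χ x := by
  refine forall₃_congr fun e _ hxe => not_congr ?_
  rw [kempeFlip_of_mem hx hxe, Option.map_eq_some_iff]
  constructor
  · rintro ⟨d, hd, rfl⟩
    rw [Equiv.swap_apply_self, hd]
  · exact fun h => ⟨_, h, Equiv.swap_apply_self _ _ _⟩

theorem mem_missing_kempeFlip_of_notMem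
    (hK : ∀ x y, (kempeGraph G χ α β).Adj x y → x ∈ K → y ∈ K) {x : V} (hx : x ∉ K) {c : C} :
    c ∈ missing G (kempeFlip χ α β K) x ↔ c ∈ missing G χ x := by
  refine forall₃_congr fun e he hxe => ?_
  rw [kempeFlip_of_notMem hK hx he hxe]

theorem Proper.kempeFlip (hχ : Proper G χ)
    (hK : ∀ x y, (kempeGraph G χ α β).Adj x y → x ∈ K → y ∈ K) :
    Proper G (kempeFlip χ α β K) := by
  rintro e₁ h₁ e₂ h₂ hne ⟨x, hx₁, hx₂⟩ c hc₁ hc₂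
  by_cases hx : x ∈ K
  · rw [kempeFlip_of_mem hx hx₁, Option.map_eq_some_iff] at hc₁
    rw [kempeFlip_of_mem hx hx₂, Option.map_eq_some_iff] at hc₂
    obtain ⟨d, hd, rfl⟩ := hc₁
    obtain ⟨d', hd', h⟩ := hc₂
    obtain rfl := (Equiv.swap α β).injective h
    exact hχ e₁ h₁ e₂ h₂ hne ⟨x, hx₁, hx₂⟩ _ hd hd'
  · rw [kempeFlip_of_notMem hK hx h₁ hx₁] at hc₁
    rw [kempeFlip_of_notMem hK hx h₂ hx₂] at hc₂
    exact hχ e₁ h₁ e₂ h₂ hne ⟨x, hx₁, hx₂⟩ c hc₁ hc₂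

theorem uncolored_kempeFlip : uncolored G (kempeFlip χ α β K) = uncolored G χ := by
  ext e
  refine and_congr_right fun _ => ?_
  unfold _root_.kempeFlip
  split_ifs <;> simp

theorem Proper.update (hχ : Proper G χ) {u v : V} {c : C} (hu : c ∈ missing G χ u)
    (hv : c ∈ missing G χ v) : Proper G (Function.update χ s(u, v) (some c)) := by
  have key : ∀ e ∈ G.edgeSet, ∀ x ∈ s(u, v), x ∈ e → χ e ≠ some c := by
    intro e he x hx hxe
    rcases Sym2.mem_iff.1 hx with rfl | rfl
    · exact hu e he hxe
    · exact hv e he hxe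
  rintro e₁ h₁ e₂ h₂ hne ⟨x, hx₁, hx₂⟩ d hd₁ hd₂
  by_cases he₁ : e₁ = s(u, v)
  · subst he₁
    rw [Function.update_self, Option.some.injEq] at hd₁
    rw [Function.update_of_ne hne.symm, ← hd₁] at hd₂
    exact key e₂ h₂ x hx₁ hx₂ hd₂
  · rw [Function.update_of_ne he₁] at hd₁
    by_cases he₂ : e₂ = s(u, v)
    · subst he₂
      rw [Function.update_self, Option.some.injEq] at hd₂
      exact key e₁ h₁ x hx₂ hx₁ (hd₂ ▸ hd₁)
    · rw [Function.update_of_ne he₂] at hd₂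
      exact hχ e₁ h₁ e₂ h₂ hne ⟨x, hx₁, hx₂⟩ d hd₁ hd₂

theorem uncolored_update (e : Sym2 V) (c : C) :
    uncolored G (Function.update χ e (some c)) = uncolored G χ \ {e} := by
  ext e'
  by_cases h : e' = e
  · subst h; simp [uncolored]
  · simp [uncolored, h]

theorem mem_missing_update {u v x : V} {c d : C} (h : (x ≠ u ∧ x ≠ v) ∨ d ≠ c)
    (hd : d ∈ missing G χ x) : d ∈ missing G (Function.update χ s(u, v) (some c)) x := by
  intro e he hxe hed
  by_cases h' : e = s(u, v)
  · subst h'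
    rw [Function.update_self, Option.some.injEq] at hed
    rcases h with h | h
    · rcases Sym2.mem_iff.1 hxe with rfl | rfl
      · exact h.1 rfl
      · exact h.2 rfl
    · exact h hed.symm
  · rw [Function.update_of_ne h'] at hed
    exact hd e he hxe hed

/-- If `α` is missing at `u`, `β` is missing at `v`, and `u`, `v` are not joined by an
`α`/`β`-alternating path, then after a Kempe change the edge `uv` can be colored; only the
availability of `α` and `β` at three vertices is affected. -/
theorem Proper.exists_color_edge [Fintype V] (hχ : Proper G χ) {u v : V}
    (hu : α ∈ missing G χ u) (hv : β ∈ missing G χ v)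
    (huv : ¬ (kempeGraph G χ α β).Reachable v u) :
    ∃ (χ' : Sym2 V → Option C) (y : V), Proper G χ' ∧
      uncolored G χ' = uncolored G χ \ {s(u, v)} ∧
      ∀ x c, c ∈ missing G χ x → ((x ≠ u ∧ x ≠ v ∧ x ≠ y) ∨ (c ≠ α ∧ c ≠ β)) →
        c ∈ missing G χ' x := by
  set H := kempeGraph G χ α β with hH
  set K : Set V := {x | H.Reachable v x}
  have hvK : v ∈ K := SimpleGraph.Reachable.refl v
  have hK : ∀ x y, H.Adj x y → x ∈ K → y ∈ K := fun x y hxy hx => hx.trans hxy.reachable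
  obtain ⟨y, hy⟩ : ∃ y, ∀ x ∈ K, (α ∈ missing G χ x ∨ β ∈ missing G χ x) → x = v ∨ x = y := by
    by_contra! hcon
    obtain ⟨y, hyK, hym, hyv, -⟩ := hcon v
    obtain ⟨z, hzK, hzm, hzv, hzy⟩ := hcon y
    exact H.not_three_ends (hχ.kempeGraph_degree_le_two α β) hyv.symm hzv.symm hzy.symm
      (hχ.kempeGraph_degree_le_one (.inr hv)) (hχ.kempeGraph_degree_le_one hym)
      (hχ.kempeGraph_degree_le_one hzm) hyK hzK
  refine ⟨Function.update (_root_.kempeFlip χ α β K) s(u, v) (some α), y,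
    (hχ.kempeFlip hK).update ?_ ?_, ?_, ?_⟩
  · exact (mem_missing_kempeFlip_of_notMem hK huv).2 hu
  · exact (mem_missing_kempeFlip_of_mem hvK).2 (by rwa [Equiv.swap_apply_left])
  · rw [uncolored_update, uncolored_kempeFlip]
  · intro x c hc h
    refine mem_missing_update (h.imp (fun h => ⟨h.1, h.2.1⟩) And.left) ?_
    by_cases hx : x ∈ K
    · rw [mem_missing_kempeFlip_of_mem hx]
      by_cases hcc : c ≠ α ∧ c ≠ β
      · rwa [Equiv.swap_apply_of_ne_of_ne hcc.1 hcc.2]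
      · have hm : α ∈ missing G χ x ∨ β ∈ missing G χ x := by
          by_cases hα : c = α
          · exact .inl (hα ▸ hc)
          · exact .inr (by rwa [← not_not.1 fun hβ => hcc ⟨hα, hβ⟩])
        have h' := h.resolve_right hcc
        exact ((hy x hx hm).elim h'.2.1 h'.2.2).elim
    · exact (mem_missing_kempeFlip_of_notMem hK hx).2 hc

/-- Activating a u-fan colors one of its two edges. -/
theorem IsUFan.exists_color_edge [Fintype V] (hχ : Proper G χ) {f : UFan V C}
    (hf : IsUFan G χ f) :
    ∃ (χ' : Sym2 V → Option C) (e : Sym2 V) (a b c : V), Proper G χ' ∧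
      e ∈ f.edges ∧ uncolored G χ' = uncolored G χ \ {e} ∧
      ∀ x d, d ∈ missing G χ x → ((x ≠ a ∧ x ≠ b ∧ x ≠ c) ∨ (d ≠ f.cu ∧ d ≠ f.cv)) →
        d ∈ missing G χ' x := by
  obtain ⟨huv, huw, hvw, -, -, hu, hv, hw, -, hcvw⟩ := hf
  rw [← hcvw] at hw
  by_cases h₁ : (kempeGraph G χ f.cu f.cv).Reachable f.v f.u
  · by_cases h₂ : (kempeGraph G χ f.cu f.cv).Reachable f.w f.u
    · exact (SimpleGraph.not_three_ends _ (hχ.kempeGraph_degree_le_two _ _) huv huw hvw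
        (hχ.kempeGraph_degree_le_one (.inl hu)) (hχ.kempeGraph_degree_le_one (.inr hv))
        (hχ.kempeGraph_degree_le_one (.inr hw)) h₁.symm h₂.symm).elim
    · obtain ⟨χ', y, h, h', h''⟩ := hχ.exists_color_edge hu hw h₂
      exact ⟨χ', _, _, _, y, h, .inr rfl, h', h''⟩
  · obtain ⟨χ', y, h, h', h''⟩ := hχ.exists_color_edge hu hv h₁
    exact ⟨χ', _, _, _, y, h, .inl rfl, h', h''⟩

end Kempe

theorem Separable.mono {V C : Type*} {𝒰 𝒱 : Finset (UFan V C)} (h : Separable 𝒰) (hsub : 𝒱 ⊆ 𝒰) :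
    Separable 𝒱 :=
  ⟨fun f hf g hg => h.1 f (hsub hf) g (hsub hg), fun f hf g hg => h.2 f (hsub hf) g (hsub hg)⟩

/-- In a separable collection, each vertex-color pair is assigned by at most one fan. -/
theorem Separable.card_assigns_le {V C : Type*} {𝒰 : Finset (UFan V C)} (h : Separable 𝒰)
    (P : Finset (V × C)) :
    (𝒰.filter fun g => ∃ p ∈ P, g.assigns p.1 p.2).card ≤ P.card := by
  have hex : ∀ g ∈ 𝒰.filter (fun g => ∃ p ∈ P, g.assigns p.1 p.2),
      ∃ p ∈ P, g.assigns p.1 p.2 := fun g hg => (Finset.mem_filter.1 hg).2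
  rcases isEmpty_or_nonempty (V × C) with _ | _
  · simp
  choose! φ hφ hφa using hex
  refine Finset.card_le_card_of_injOn φ hφ fun g hg g' hg' heq => ?_
  by_contra hne
  exact h.2 g (Finset.mem_filter.1 hg).1 g' (Finset.mem_filter.1 hg').1 hne _ _ (hφa g hg)
    (heq ▸ hφa g' hg')

/-- **Lemma 3.2 (existential content of Color-Small).** -/
theorem color_small_exists
    {V C : Type*} [Fintype V] [Fintype C]
    (G : SimpleGraph V) (χ : Sym2 V → Option C) (hproper : Proper G χ)
    (𝒰 : Finset (UFan V C)) (h𝒰 : ∀ f ∈ 𝒰, IsUFan G χ f) (hsep : Separable 𝒰) :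
    ∃ χ' : Sym2 V → Option C,
      Proper G χ' ∧ uncolored G χ' ⊆ uncolored G χ ∧
      100 * (uncolored G χ').ncard + 𝒰.card ≤ 100 * (uncolored G χ).ncard := by
  induction h : 𝒰.card using Nat.strong_induction_on generalizing χ 𝒰 with
  | _ n ih =>
  subst h
  rcases 𝒰.eq_empty_or_nonempty with rfl | ⟨f, hf⟩
  · exact ⟨χ, hproper, subset_rfl, by simp⟩
  obtain ⟨χ₁, e, a, b, c, hχ₁, he, hunc, hmiss⟩ := (h𝒰 f hf).exists_color_edge hproper
  have he_unc : e ∈ uncolored G χ := by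
    obtain ⟨-, -, -, h₁, h₂, -⟩ := h𝒰 f hf
    rcases he with rfl | rfl
    exacts [h₁, h₂]
  let P : Finset (V × C) := insert (f.u, f.cu) ({a, b, c} ×ˢ {f.cu, f.cv})
  have hP : P.card ≤ 7 := by
    refine (Finset.card_insert_le _ _).trans (Nat.succ_le_succ ?_)
    rw [Finset.card_product]
    exact Nat.mul_le_mul Finset.card_le_three Finset.card_le_two
  let 𝒱 := 𝒰.filter fun g => ¬ ∃ p ∈ P, g.assigns p.1 p.2
  have hsub : 𝒱 ⊆ 𝒰 := Finset.filter_subset _ _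
  have hcard := 𝒰.card_filter_add_card_filter_not (fun g => ∃ p ∈ P, g.assigns p.1 p.2)
  have hcov := hsep.card_assigns_le P
  have hf𝒱 : f ∉ 𝒱 := fun hmem =>
    (Finset.mem_filter.1 hmem).2 ⟨(f.u, f.cu), Finset.mem_insert_self _ _, .inl ⟨rfl, rfl⟩⟩
  have hlt : 𝒱.card < 𝒰.card :=
    Finset.card_lt_card (Finset.ssubset_iff_of_subset hsub |>.2 ⟨f, hf, hf𝒱⟩)
  have hfan : ∀ g ∈ 𝒱, IsUFan G χ₁ g := by
    intro g hg
    obtain ⟨hg𝒰, hgP⟩ := Finset.mem_filter.1 hg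
    have hgf : f ≠ g := by rintro rfl; exact hf𝒱 hg
    have hge : e ∉ g.edges := Set.disjoint_left.1 (hsep.1 f hf g hg𝒰 hgf) he
    have hm : ∀ x d, g.assigns x d → d ∈ missing G χ x → d ∈ missing G χ₁ x := by
      intro x d hxd hd
      refine hmiss x d hd ?_
      by_contra hcon
      refine hgP ⟨(x, d), Finset.mem_insert_of_mem ?_, hxd⟩
      simp only [Finset.mem_product, Finset.mem_insert, Finset.mem_singleton]
      tauto
    obtain ⟨h₁, h₂, h₃, h₄, h₅, h₆, h₇, h₈, h₉⟩ := h𝒰 g hg𝒰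
    refine ⟨h₁, h₂, h₃, ?_, ?_, hm _ _ (.inl ⟨rfl, rfl⟩) h₆, hm _ _ (.inr (.inl ⟨rfl, rfl⟩)) h₇,
      hm _ _ (.inr (.inr ⟨rfl, rfl⟩)) h₈, h₉⟩
    · rw [hunc]
      exact ⟨h₄, fun h => hge (.inl h.symm)⟩
    · rw [hunc]
      exact ⟨h₅, fun h => hge (.inr h.symm)⟩
  obtain ⟨χ', hχ', hunc', hle⟩ := ih 𝒱.card hlt χ₁ hχ₁ 𝒱 hfan (hsep.mono hsub) rfl
  refine ⟨χ', hχ', hunc'.trans (hunc ▸ Set.sdiff_subset), ?_⟩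
  have hone := Set.ncard_sdiff_singleton_add_one he_unc (Set.toFinite _)
  rw [← hunc] at hone
  change _ + 𝒱.card = _ at hcard
  omega
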